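/- Let a and b be coprime positive integers with a + b odd. Then the Hardy–Berndt sum satisfies S(a;b) = 8·s(a;2b) + 8·s(2a;b) − 20·s(a;b). -/

import Mathlib

open Finset Real

/-- The classical Dedekind sum `s(a;b)` defined by the cotangent sum. -/
noncomputable def dedekindS (a : ℤ) (b : ℕ) : ℝ :=
  (1 / (4 * (b : ℝ))) * ∑ ν ∈ Finset.Ico 1 b,
    Real.cot (Real.pi * a * ν / b) * Real.cot (Real.pi * ν / b)

/-- The Hardy–Berndt sum . -/
def hardyBerndtS (a b : ℕ) : ℤ :=
  ∑ μ ∈ Finset.Ico 1 b, (-1 : ℤ) ^ (μ + 1 + a * μ / b)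

lemma hb_cot_add_half (x : ℝ) : Real.cot (x + π / 2) = 2 * Real.cot (2 * x) - Real.cot x := by
  simp only [Real.cot_eq_cos_div_sin, Real.cos_add_pi_div_two, Real.sin_add_pi_div_two,
    Real.sin_two_mul, Real.cos_two_mul']
  by_cases h1 : Real.sin x = 0
  · simp [h1]
  by_cases h2 : Real.cos x = 0
  · simp [h2]
  field_simp
  ring

lemma hb_cot_add_pi (x : ℝ) (k : ℕ) : Real.cot (x + k * π) = Real.cot x := by
  rw [Real.cot_eq_cos_div_sin, Real.cot_eq_cos_div_sin, Real.cos_add_nat_mul_pi,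
    Real.sin_add_nat_mul_pi]
  exact mul_div_mul_left _ _ (pow_ne_zero _ (by norm_num))

lemma hb_ded (a : ℤ) (b : ℕ) (hb : 0 < b) :
    4 * (b : ℝ) * dedekindS a b =
      ∑ ν ∈ Finset.range b, Real.cot (π * a * ν / b) * Real.cot (π * ν / b) := by
  have hb' : (b : ℝ) ≠ 0 := by positivity
  rw [Finset.range_eq_Ico, Finset.sum_eq_sum_Ico_succ_bot hb, dedekindS]
  have h0 : Real.cot 0 = 0 := by simp [Real.cot_eq_cos_div_sin]
  simp only [Nat.cast_zero, mul_zero, zero_div, h0, zero_add]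
  field_simp

lemma hb_split (f : ℕ → ℝ) (b : ℕ) : ∑ ν ∈ Finset.range (2 * b), f ν =
    ∑ k ∈ Finset.range b, f (2 * k) + ∑ k ∈ Finset.range b, f (2 * k + 1) := by
  induction b with
  | zero => simp
  | succ n ih =>
    rw [show 2 * (n + 1) = 2 * n + 1 + 1 by ring, Finset.sum_range_succ, Finset.sum_range_succ, ih,
      Finset.sum_range_succ, Finset.sum_range_succ]
    ring

noncomputable def hbT (b k : ℕ) : ℝ := π * (2 * k + 1) / (2 * b)

lemma hb_cos_sum (b n : ℕ) (hn : 0 < n) (hnb : n < b) :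
    ∑ k ∈ Finset.range b, Real.cos (2 * n * hbT b k) = 0 := by
  have hb : (0 : ℝ) < b := by exact_mod_cast (by omega : 0 < b)
  have hn' : (0 : ℝ) < n := by exact_mod_cast hn
  have hnb' : (n : ℝ) < b := by exact_mod_cast hnb
  set x : ℝ := π * n / b with hx
  have hs : 0 < Real.sin x := by
    apply Real.sin_pos_of_pos_of_lt_pi
    · positivity
    · rw [hx, div_lt_iff₀ hb]; exact mul_lt_mul_of_pos_left hnb' Real.pi_pos
  have key : ∀ N : ℕ, 2 * Real.sin x * ∑ k ∈ Finset.range N, Real.cos (2 * n * hbT b k)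
      = Real.sin (2 * N * x) := by
    intro N
    induction N with
    | zero => simp
    | succ N ih =>
      rw [Finset.sum_range_succ, mul_add, ih]
      have e : 2 * n * hbT b N = 2 * N * x + x := by
        rw [hx, hbT]; field_simp
      rw [e, show 2 * ((N + 1 : ℕ) : ℝ) * x = (2 * N * x + x) + x by push_cast; ring]
      have e2 : Real.sin (2 * N * x) = Real.sin ((2 * N * x + x) - x) := by congr 1; ring
      rw [e2, Real.sin_sub, Real.sin_add (2 * N * x + x) x]
      ring
  have h := key b
  have e : 2 * b * x = ((2 * n : ℕ) : ℝ) * π := by rw [hx]; push_cast; field_simp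
  rw [e, Real.sin_nat_mul_pi] at h
  rcases mul_eq_zero.1 h with h | h
  · linarith
  · exact h

lemma hb_sinT (b k : ℕ) (hk : k < b) : Real.sin (hbT b k) ≠ 0 := by
  have hb : (0 : ℝ) < b := by exact_mod_cast (by omega : 0 < b)
  have hk' : (k : ℝ) + 1 ≤ b := by exact_mod_cast hk
  apply ne_of_gt
  apply Real.sin_pos_of_pos_of_lt_pi
  · unfold hbT; positivity
  · rw [hbT, div_lt_iff₀ (by positivity)]
    exact mul_lt_mul_of_pos_left (by linarith) Real.pi_pos

noncomputable def hbE (b n : ℕ) : ℝ :=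
  ∑ k ∈ Finset.range b, Real.cot (hbT b k) * Real.sin (2 * n * hbT b k)

lemma hbE_step (b n : ℕ) : hbE b (n + 1) = hbE b n +
    (∑ k ∈ Finset.range b, Real.cos (2 * (n + 1 : ℕ) * hbT b k) +
      ∑ k ∈ Finset.range b, Real.cos (2 * n * hbT b k)) := by
  unfold hbE
  rw [← Finset.sum_add_distrib, ← Finset.sum_add_distrib]
  apply Finset.sum_congr rfl
  intro k hk
  have hs := hb_sinT b k (Finset.mem_range.1 hk)
  set t := hbT b k
  rw [show 2 * ((n + 1 : ℕ) : ℝ) * t = (2 * n * t + t) + t by push_cast; ring]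
  have e : 2 * n * t = (2 * n * t + t) - t := by ring
  generalize 2 * n * t + t = y at *
  rw [e, Real.cot_eq_cos_div_sin, Real.sin_sub, Real.sin_add, Real.cos_sub, Real.cos_add]
  field_simp
  ring

lemma hbE_one (b n : ℕ) (hnb : n + 1 < b) : hbE b (n + 1) = b := by
  induction n with
  | zero =>
    rw [hbE_step, hb_cos_sum b (0 + 1) (by omega) hnb]
    simp [hbE]
  | succ n ih =>
    rw [hbE_step, hb_cos_sum b _ (by omega) hnb, hb_cos_sum b _ (by omega) (by omega),
      ih (by omega)]
    ring

lemma hbE_per (b n j : ℕ) (hb : 0 < b) : hbE b (n + b * j) = (-1) ^ j * hbE b n := by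
  have hb' : (b : ℝ) ≠ 0 := by positivity
  unfold hbE
  rw [Finset.mul_sum]
  apply Finset.sum_congr rfl
  intro k _
  have e : 2 * ((n + b * j : ℕ) : ℝ) * hbT b k = 2 * n * hbT b k + (((2 * k + 1) * j : ℕ) : ℝ) * π := by
    unfold hbT; push_cast; field_simp
  rw [e, Real.sin_add_nat_mul_pi, pow_mul, Odd.neg_one_pow ⟨k, rfl⟩]
  ring

lemma hb_sin_sum (b : ℕ) (hb : 0 < b) (φ : ℝ) (hc : Real.cos (2 * b * φ) = -1) :
    ∑ μ ∈ Finset.Ico 1 b, Real.sin (2 * μ * φ) = Real.cot φ := by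
  have hs2 : Real.sin (2 * b * φ) = 0 := by
    have := Real.sin_sq_add_cos_sq (2 * b * φ)
    rw [hc] at this
    have h : Real.sin (2 * b * φ) ^ 2 = 0 := by linarith
    exact pow_eq_zero_iff (two_ne_zero) |>.1 h
  have hs : Real.sin φ ≠ 0 := by
    intro h
    obtain ⟨n, hn⟩ := Real.sin_eq_zero_iff.1 h
    have : 2 * b * φ = ((b * n : ℤ) : ℝ) * (2 * π) := by rw [← hn]; push_cast; ring
    rw [this, Real.cos_int_mul_two_pi] at hc
    norm_num at hc
  have key : ∀ N : ℕ, 2 * Real.sin φ * ∑ μ ∈ Finset.range N, Real.sin (2 * μ * φ)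
      = Real.cos φ - Real.cos (2 * N * φ - φ) := by
    intro N
    induction N with
    | zero => simp
    | succ N ih =>
      rw [Finset.sum_range_succ, mul_add, ih,
        show 2 * ((N + 1 : ℕ) : ℝ) * φ - φ = 2 * N * φ + φ by push_cast; ring,
        Real.cos_sub, Real.cos_add]
      ring
  have h := key b
  rw [Finset.range_eq_Ico, Finset.sum_eq_sum_Ico_succ_bot hb, Real.cos_sub, hc, hs2] at h
  simp only [Nat.cast_zero, mul_zero, zero_mul, Real.sin_zero, zero_add] at h
  rw [Real.cot_eq_cos_div_sin, eq_div_iff hs]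
  linarith

lemma hb_S (a b : ℕ) (hb : 0 < b) (hcop : Nat.gcd a b = 1) (hodd : Odd (a + b)) :
    (b : ℝ) * (hardyBerndtS a b : ℝ) =
      - ∑ k ∈ Finset.range b, Real.cot (hbT b k) * Real.cot ((a + b : ℕ) * hbT b k) := by
  have hb' : (b : ℝ) ≠ 0 := by positivity
  have h1 : (b : ℝ) * (hardyBerndtS a b : ℝ) = - ∑ μ ∈ Finset.Ico 1 b, hbE b ((a + b) * μ) := by
    unfold hardyBerndtS
    push_cast
    rw [Finset.mul_sum, ← Finset.sum_neg_distrib]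
    apply Finset.sum_congr rfl
    intro μ hμ
    rw [Finset.mem_Ico] at hμ
    have hpos : 0 < a * μ % b := by
      rw [Nat.pos_iff_ne_zero]
      intro h
      have h2 : b ∣ μ := (Nat.Coprime.symm hcop).dvd_of_dvd_mul_left (Nat.dvd_of_mod_eq_zero h)
      have := Nat.le_of_dvd (by omega) h2
      omega
    have hlt := Nat.mod_lt (a * μ) hb
    have e : (a + b) * μ = ((a * μ % b - 1) + 1) + b * (μ + a * μ / b) := by
      rw [Nat.sub_add_cancel hpos, mul_add, add_mul]
      have := Nat.mod_add_div (a * μ) b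
      omega
    rw [e, hbE_per _ _ _ hb, hbE_one _ _ (by omega)]
    ring
  rw [h1]
  congr 1
  unfold hbE
  rw [Finset.sum_comm]
  apply Finset.sum_congr rfl
  intro k _
  rw [← Finset.mul_sum]
  congr 1
  rw [← hb_sin_sum b hb]
  · apply Finset.sum_congr rfl
    intro μ _
    congr 1
    push_cast
    ring
  · have e : 2 * b * (((a + b : ℕ) : ℝ) * hbT b k) = (((a + b) * (2 * k + 1) : ℕ) : ℝ) * π := by
      unfold hbT; push_cast; field_simp
    rw [e, Real.cos_nat_mul_pi, Odd.neg_one_pow (hodd.mul ⟨k, rfl⟩)]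

theorem hardyBerndt_eq (a b : ℕ) (ha : 0 < a) (hb : 0 < b) (hcop : Nat.gcd a b = 1)
    (hodd : Odd (a + b)) :
    (hardyBerndtS a b : ℝ) =
      8 * dedekindS a (2 * b) + 8 * dedekindS (2 * a) b - 20 * dedekindS a b := by
  have hb' : (b : ℝ) ≠ 0 := by positivity
  have hS := hb_S a b hb hcop hodd
  have d1 := hb_ded a (2 * b) (by omega)
  have d2 := hb_ded (2 * a) b hb
  have d3 := hb_ded a b hb
  have c1 : ∀ k ∈ Finset.range b, Real.cot (hbT b k) * Real.cot ((a + b : ℕ) * hbT b k) =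
      2 * (Real.cot (hbT b k) * Real.cot (2 * (a * hbT b k))) -
        Real.cot (hbT b k) * Real.cot (a * hbT b k) := by
    intro k _
    have e : ((a + b : ℕ) : ℝ) * hbT b k = (a * hbT b k + π / 2) + (k : ℕ) * π := by
      unfold hbT; push_cast; field_simp; ring
    rw [e, hb_cot_add_pi, hb_cot_add_half]
    ring
  rw [Finset.sum_congr rfl c1, Finset.sum_sub_distrib, ← Finset.mul_sum] at hS
  -- first sum
  have s1 : ∑ k ∈ Finset.range b, Real.cot (hbT b k) * Real.cot (a * hbT b k) =
      8 * b * dedekindS a (2 * b) - 4 * b * dedekindS a b := by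
    rw [hb_split] at d1
    have e1 : ∑ k ∈ Finset.range b, Real.cot (π * (a : ℤ) * (2 * k : ℕ) / (2 * b : ℕ)) *
        Real.cot (π * (2 * k : ℕ) / (2 * b : ℕ)) = 4 * b * dedekindS a b := by
      rw [d3]
      apply Finset.sum_congr rfl
      intro k _
      congr 2 <;> · push_cast; field_simp
    have e2 : ∑ k ∈ Finset.range b, Real.cot (π * (a : ℤ) * (2 * k + 1 : ℕ) / (2 * b : ℕ)) *
        Real.cot (π * (2 * k + 1 : ℕ) / (2 * b : ℕ)) =
        ∑ k ∈ Finset.range b, Real.cot (hbT b k) * Real.cot (a * hbT b k) := by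
      apply Finset.sum_congr rfl
      intro k _
      rw [mul_comm]
      unfold hbT
      congr 2 <;> · push_cast; field_simp
    rw [e1, e2] at d1
    push_cast at d1
    linarith
  have s2 : ∑ k ∈ Finset.range b, Real.cot (hbT b k) * Real.cot (2 * (a * hbT b k)) =
      8 * b * dedekindS a b - 4 * b * dedekindS (2 * a) b := by
    have hsp := hb_split (fun ν => Real.cot (π * ν / (2 * b)) * Real.cot (π * a * ν / b)) b
    have e0 : ∑ ν ∈ Finset.range (2 * b), Real.cot (π * ν / (2 * b)) * Real.cot (π * a * ν / b) =
        2 * (4 * b * dedekindS a b) := by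
      rw [two_mul b, Finset.sum_range_add, ← Finset.sum_add_distrib, d3, Finset.mul_sum]
      apply Finset.sum_congr rfl
      intro k _
      have f1 : π * ((b + k : ℕ) : ℝ) / (2 * b) = π * k / (2 * b) + π / 2 := by
        push_cast; field_simp; ring
      have f2 : π * a * ((b + k : ℕ) : ℝ) / b = π * a * k / b + a * π := by
        push_cast; field_simp; ring
      have f3 : 2 * (π * k / (2 * b)) = π * k / b := by field_simp
      rw [f1, f2, hb_cot_add_pi, hb_cot_add_half, f3]
      push_cast
      ring
    have e1 : ∑ k ∈ Finset.range b, Real.cot (π * (2 * k : ℕ) / (2 * b)) *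
        Real.cot (π * a * (2 * k : ℕ) / b) = 4 * b * dedekindS (2 * a) b := by
      rw [d2]
      apply Finset.sum_congr rfl
      intro k _
      rw [mul_comm]
      congr 2 <;> · push_cast; field_simp
    have e2 : ∑ k ∈ Finset.range b, Real.cot (π * (2 * k + 1 : ℕ) / (2 * b)) *
        Real.cot (π * a * (2 * k + 1 : ℕ) / b) =
        ∑ k ∈ Finset.range b, Real.cot (hbT b k) * Real.cot (2 * (a * hbT b k)) := by
      apply Finset.sum_congr rfl
      intro k _
      unfold hbT
      congr 2 <;> · push_cast; field_simp
    rw [e0, e1, e2] at hsp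
    linarith
  rw [s1, s2] at hS
  apply mul_left_cancel₀ hb'
  rw [hS]
  ring
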